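/- For p ≥ r ≥ s ≥ 1, the rank-generating function of partitions with distinct parts contained inside λ = ⟨p+2, r+1, s⟩ satisfies F_λ(q) = q^3·G_{(p,r,s)}(q) + (1 + q + q^2 + ... + q^{p+2}), where G_{(p,r,s)}(q) is the rank-generating function of arbitrary partitions contained in the shape (p, r, s). -/

import Mathlib

/-- `μ` is a partition with distinct parts (strictly decreasing positive parts,
followed by a tail of zeros), encoded as a function `Fin b → ℕ`. -/
def DistinctParts {b : ℕ} (μ : Fin b → ℕ) : Prop :=
  ∀ i j : Fin b, i < j → μ j = 0 ∨ μ j < μ i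

/-- `μ` is a partition with distinct parts contained inside the shifted shape `lam`. -/
def FitsD {b : ℕ} (lam μ : Fin b → ℕ) : Prop :=
  DistinctParts μ ∧ ∀ i, μ i ≤ lam i

/-- The coefficient of `q^k` in the rank-generating function `F_lam`:
the number of partitions with distinct parts of size `k` contained inside `lam`. -/
noncomputable def Fcoeff {b : ℕ} (lam : Fin b → ℕ) (k : ℕ) : ℕ :=
  Nat.card {μ : Fin b → ℕ // FitsD lam μ ∧ ∑ i, μ i = k}

/-- The coefficient of `q^k` in the rank-generating function `G_lam` of arbitrary
partitions contained inside the straight Ferrers shape `lam`. -/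
noncomputable def Gcoeff {b : ℕ} (lam : Fin b → ℕ) (k : ℕ) : ℕ :=
  Nat.card {μ : Fin b → ℕ // Antitone μ ∧ (∀ i, μ i ≤ lam i) ∧ ∑ i, μ i = k}

/-- The coefficient of `q^i` in the Gaussian binomial coefficient `(m choose k)_q`,
which is the rank-generating function of partitions inside a `k × (m-k)` rectangle. -/
noncomputable def gaussCoeff (m k i : ℕ) : ℕ :=
  Gcoeff (fun _ : Fin k => m - k) i

theorem fitsD_three_iff (a b c : ℕ) (μ : Fin 3 → ℕ) :
    FitsD ![a, b, c] μ ↔ (μ 1 = 0 ∨ μ 1 < μ 0) ∧ (μ 2 = 0 ∨ μ 2 < μ 0) ∧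
      (μ 2 = 0 ∨ μ 2 < μ 1) ∧ μ 0 ≤ a ∧ μ 1 ≤ b ∧ μ 2 ≤ c := by
  simp [FitsD, DistinctParts, Fin.forall_fin_succ]
  tauto

theorem antitone_fin_three_iff (μ : Fin 3 → ℕ) :
    Antitone μ ↔ μ 1 ≤ μ 0 ∧ μ 2 ≤ μ 1 := by
  rw [Fin.antitone_iff_succ_le]
  simp [Fin.forall_fin_succ]

theorem finite_fitsD {b : ℕ} (lam : Fin b → ℕ) : {μ | FitsD lam μ}.Finite :=
  (Set.finite_Iic lam).subset fun _ h => h.2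

/-- Subtracting the staircase `(2, 1, 0)` identifies the distinct-part partitions with at least two
parts with the ordinary partitions whose size is smaller by `3`. -/
theorem ncard_fitsD_two_le_parts (p r s k : ℕ) :
    {μ : Fin 3 → ℕ | (FitsD ![p + 2, r + 1, s] μ ∧ ∑ i, μ i = k) ∧ μ 1 ≠ 0}.ncard =
      if 3 ≤ k then Gcoeff ![p, r, s] (k - 3) else 0 := by
  split_ifs with hk
  · rw [Gcoeff]
    refine (Nat.card_congr ?_ : Nat.card {μ : Fin 3 → ℕ // _} = _)
    refine
      { toFun := fun μ => ⟨![μ.1 0 - 2, μ.1 1 - 1, μ.1 2], ?_⟩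
        invFun := fun ν => ⟨![ν.1 0 + 2, ν.1 1 + 1, ν.1 2], ?_⟩
        left_inv := ?_
        right_inv := ?_ }
    · obtain ⟨μ, ⟨h, hsum⟩, h1⟩ := μ
      rw [fitsD_three_iff] at h
      rw [antitone_fin_three_iff]
      simp [Fin.sum_univ_three, Fin.forall_fin_succ] at hsum ⊢
      omega
    · obtain ⟨ν, h, hle, hsum⟩ := ν
      rw [antitone_fin_three_iff] at h
      simp [Fin.sum_univ_three, Fin.forall_fin_succ] at hle hsum
      simp [fitsD_three_iff, Fin.sum_univ_three]
      omega
    · rintro ⟨μ, ⟨h, hsum⟩, h1⟩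
      rw [fitsD_three_iff] at h
      ext i
      fin_cases i <;> simp <;> omega
    · rintro ⟨ν, h⟩
      ext i
      fin_cases i <;> simp
  · rw [Set.ncard_eq_zero ((finite_fitsD _).subset fun _ h => h.1.1),
      Set.eq_empty_iff_forall_notMem]
    rintro μ ⟨⟨h, hsum⟩, h1⟩
    rw [fitsD_three_iff] at h
    rw [Fin.sum_univ_three] at hsum
    omega

theorem ncard_fitsD_le_one_part (p r s k : ℕ) :
    {μ : Fin 3 → ℕ | (FitsD ![p + 2, r + 1, s] μ ∧ ∑ i, μ i = k) ∧ μ 1 = 0}.ncard =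
      if k ≤ p + 2 then 1 else 0 := by
  split_ifs with hk
  · rw [Set.ncard_eq_one]
    refine ⟨![k, 0, 0], Set.ext fun μ => ?_⟩
    simp only [Set.mem_ofPred_eq, Set.mem_singleton_iff, fitsD_three_iff, Fin.sum_univ_three,
      funext_iff, Fin.forall_fin_succ]
    simp
    omega
  · rw [Set.ncard_eq_zero ((finite_fitsD _).subset fun _ h => h.1.1),
      Set.eq_empty_iff_forall_notMem]
    rintro μ ⟨⟨h, hsum⟩, h1⟩
    rw [fitsD_three_iff] at h
    rw [Fin.sum_univ_three] at hsum
    omega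

/-- For `p ≥ r ≥ s ≥ 1` and `λ = ⟨p+2, r+1, s⟩`,
`F_λ(q) = q³ G_{(p,r,s)}(q) + (1 + q + ⋯ + q^{p+2})`, stated coefficientwise. -/
theorem three_parts_decomposition (p r s : ℕ) (hrp : r ≤ p) (hsr : s ≤ r) (hs : 1 ≤ s) :
    ∀ k : ℕ, Fcoeff ![p + 2, r + 1, s] k =
      (if 3 ≤ k then Gcoeff ![p, r, s] (k - 3) else 0) +
      (if k ≤ p + 2 then 1 else 0) := by
  intro k
  rw [← ncard_fitsD_two_le_parts, ← ncard_fitsD_le_one_part p r s k,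
    ← Set.ncard_union_eq (Set.disjoint_left.2 fun _ h h' => h.2 h'.2)
      ((finite_fitsD _).subset fun _ h => h.1.1) ((finite_fitsD _).subset fun _ h => h.1.1)]
  change Set.ncard {μ : Fin 3 → ℕ | FitsD ![p + 2, r + 1, s] μ ∧ ∑ i, μ i = k} = _
  congr 1
  ext μ
  simp only [Set.mem_ofPred_eq, Set.mem_union]
  tauto
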